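/- Let P be a Poisson vertex algebra with λ-bracket {·_λ·}, and for an odd endomorphism D of P define the induced Λ-bracket {a_Λ b}⁻ := {Da_λ b} + χ{a_λ b}. Then the following are equivalent: (1) (P, 1, ∇=(∂,D), {·_Λ·}⁻, ·) is an N=1 SUSY Poisson vertex algebra; (2) D is an odd derivation of P satisfying D² = ∂ and D{a_λ b} = {Da_λ b} + (−1)^{p(a)}{a_λ Db} for all a, b ∈ P. -/

import Mathlib

noncomputable section

/-- The sign `(-1)^{ij}` for parities `i, j : ZMod 2`. -/
def sg (i j : ZMod 2) : ℂ := (-1 : ℂ) ^ (i.val * j.val)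

/-- The sign `(-1)^{i}` for a parity `i : ZMod 2`. -/
def sg1 (i : ZMod 2) : ℂ := (-1 : ℂ) ^ i.val

/-- The data of a Poisson vertex algebra structure on a unital associative
`ℂ`-superalgebra `P`: a `ℤ/2`-grading `part`, an even derivation `∂ = der`,
and a `λ`-bracket `{a_λ b} = ∑_{n≥0} (λⁿ/n!) (lb a b n)` with a support bound
`bnd`. -/
structure PVAData (P : Type) [Ring P] [Algebra ℂ P] where
  part : ZMod 2 → Submodule ℂ P
  der : P →ₗ[ℂ] P
  lb : P →ₗ[ℂ] P →ₗ[ℂ] (ℕ → P)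
  bnd : P → P → ℕ

namespace PVAData

variable {P : Type} [Ring P] [Algebra ℂ P] (d : PVAData P)

/-- The axioms of a Poisson vertex algebra (with its `ℤ/2`-grading):
`P` is a unital supercommutative associative differential superalgebra, and
the `λ`-bracket (written in coefficients, `{a_λ b} = ∑ λⁿ/n! · lb a b n`)
satisfies sesquilinearity, skewsymmetry, the Jacobi identity and the Leibniz
rule. -/
structure IsPVA : Prop where
  compl : IsCompl (d.part 0) (d.part 1)
  one_mem : (1 : P) ∈ d.part 0
  mul_mem : ∀ (i j : ZMod 2), ∀ a ∈ d.part i, ∀ b ∈ d.part j,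
    a * b ∈ d.part (i + j)
  scomm : ∀ (i j : ZMod 2), ∀ a ∈ d.part i, ∀ b ∈ d.part j,
    a * b = sg i j • (b * a)
  der_mem : ∀ (i : ZMod 2), ∀ a ∈ d.part i, d.der a ∈ d.part i
  der_mul : ∀ a b : P, d.der (a * b) = d.der a * b + a * d.der b
  lb_mem : ∀ (i j : ZMod 2), ∀ a ∈ d.part i, ∀ b ∈ d.part j, ∀ n,
    d.lb a b n ∈ d.part (i + j)
  lb_bnd : ∀ a b n, d.bnd a b ≤ n → d.lb a b n = 0
  -- sesquilinearity: `{∂a_λ b} = -λ{a_λ b}`, `{a_λ ∂b} = (∂+λ){a_λ b}`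
  sesq1₀ : ∀ a b : P, d.lb (d.der a) b 0 = 0
  sesq1 : ∀ (a b : P) (n : ℕ),
    d.lb (d.der a) b (n + 1) = -((n + 1 : ℕ) : ℂ) • d.lb a b n
  sesq2₀ : ∀ a b : P, d.lb a (d.der b) 0 = d.der (d.lb a b 0)
  sesq2 : ∀ (a b : P) (n : ℕ), d.lb a (d.der b) (n + 1) =
    d.der (d.lb a b (n + 1)) + ((n + 1 : ℕ) : ℂ) • d.lb a b n
  -- skewsymmetry: `{a_λ b} = -(-1)^{p(a)p(b)} {b_{-λ-∂} a}`
  skew : ∀ (i j : ZMod 2), ∀ a ∈ d.part i, ∀ b ∈ d.part j, ∀ n,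
    d.lb a b n = -sg i j • ∑ k ∈ Finset.range (d.bnd b a + 1),
      (((-1 : ℂ) ^ (n + k)) / (Nat.factorial k : ℂ)) •
        (d.der ^ k) (d.lb b a (n + k))
  -- Jacobi identity:
  -- `{a_λ{b_γ c}} = {{a_λ b}_{λ+γ} c} + (-1)^{p(a)p(b)}{b_γ{a_λ c}}`
  jacobi : ∀ (i j : ZMod 2), ∀ a ∈ d.part i, ∀ b ∈ d.part j, ∀ (c : P)
    (m n : ℕ), d.lb a (d.lb b c n) m =
      (∑ k ∈ Finset.range (m + 1),
        ((Nat.choose m k : ℕ) : ℂ) • d.lb (d.lb a b k) c (m + n - k)) +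
      sg i j • d.lb b (d.lb a c m) n
  -- Leibniz rule: `{a_λ bc} = {a_λ b}c + (-1)^{p(a)p(b)} b{a_λ c}`
  leibniz : ∀ (i j : ZMod 2), ∀ a ∈ d.part i, ∀ b ∈ d.part j, ∀ (c : P) (n : ℕ),
    d.lb a (b * c) n = d.lb a b n * c + sg i j • (b * d.lb a c n)

/-- The conformal weight space `P_Δ` of quasi-primary vectors for a candidate
conformal vector `L`: elements `a` with
`{L_λ a} = (2∂ + 2Δλ)a + O(λ²)`. -/
def confWtSet (L : P) (Δ : ℝ) : Set P :=
  {a | d.lb L a 0 = (2 : ℂ) • d.der a ∧ d.lb L a 1 = ((2 * Δ : ℝ) : ℂ) • a}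

/-- `L` is a conformal vector of central charge `c`:
`{L_λ L} = (2∂ + 4λ)L + (λ³/3)c` and `P` is the (bounded-below) sum of its
conformal weight spaces. -/
def IsConformalVector (L : P) (c : ℂ) : Prop :=
  L ∈ d.part 0 ∧
  d.lb L L 0 = (2 : ℂ) • d.der L ∧
  d.lb L L 1 = (4 : ℂ) • L ∧
  d.lb L L 2 = 0 ∧
  d.lb L L 3 = (2 * c) • (1 : P) ∧
  (∀ n, 4 ≤ n → d.lb L L n = 0) ∧
  ∃ M : ℝ, (∀ Δ : ℝ, Δ < M → d.confWtSet L Δ ⊆ {0}) ∧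
    Submodule.span ℂ (⋃ Δ : ℝ, d.confWtSet L Δ) = ⊤

/-- `a` is primary of conformal weight `Δ` with respect to `L`:
`{L_λ a} = (2∂ + 2Δλ)a` exactly. -/
def IsPrimary (L a : P) (Δ : ℝ) : Prop :=
  d.lb L a 0 = (2 : ℂ) • d.der a ∧
  d.lb L a 1 = ((2 * Δ : ℝ) : ℂ) • a ∧
  ∀ n, 2 ≤ n → d.lb L a n = 0

end PVAData
/-- The data of an `N=1` SUSY Poisson vertex algebra structure on a unital
associative `ℂ`-superalgebra `P`: a `ℤ/2`-grading `part`, the even derivation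
`∂ = der` and odd derivation `D = sder`, and the `Λ`-bracket
`{a_Λ b} = ∑_{n≥0} (λⁿ/n!) (lb0 a b n + χ · lb1 a b n)`
(components `lb0 a b n = a_{(n|0)} b`, `lb1 a b n = a_{(n|1)} b`). -/
structure SPVAData (P : Type) [Ring P] [Algebra ℂ P] where
  part : ZMod 2 → Submodule ℂ P
  der : P →ₗ[ℂ] P
  sder : P →ₗ[ℂ] P
  lb0 : P →ₗ[ℂ] P →ₗ[ℂ] (ℕ → P)
  lb1 : P →ₗ[ℂ] P →ₗ[ℂ] (ℕ → P)
  bnd : P → P → ℕ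

namespace SPVAData

variable {P : Type} [Ring P] [Algebra ℂ P] (d : SPVAData P)

/-- The axioms of an `N=1` SUSY Poisson vertex algebra, in terms of the
coefficients of the `Λ`-bracket
`{a_Λ b} = ∑_m (λᵐ/m!)(a_{(m|0)}b + χ a_{(m|1)}b)`, `Λ = (λ,χ)`, χ² = -λ:
`P` is a unital supercommutative associative superalgebra with even derivation
`∂` and odd derivation `D`, `D² = ∂`, and the bracket is odd and satisfies
sesquilinearity (`{Da_Λ b} = χ{a_Λ b}`,
`{a_Λ Db} = (-1)^{p(a)+1}(D+χ){a_Λ b}`), skewsymmetry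
(`{a_Λ b} = (-1)^{p(a)p(b)}{b_{-Λ-∇} a}`), the `N=1` SUSY Jacobi identity and
the Leibniz rule. -/
structure IsSPVA : Prop where
  compl : IsCompl (d.part 0) (d.part 1)
  one_mem : (1 : P) ∈ d.part 0
  mul_mem : ∀ (i j : ZMod 2), ∀ a ∈ d.part i, ∀ b ∈ d.part j,
    a * b ∈ d.part (i + j)
  scomm : ∀ (i j : ZMod 2), ∀ a ∈ d.part i, ∀ b ∈ d.part j,
    a * b = sg i j • (b * a)
  der_mem : ∀ (i : ZMod 2), ∀ a ∈ d.part i, d.der a ∈ d.part i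
  der_mul : ∀ a b : P, d.der (a * b) = d.der a * b + a * d.der b
  sder_mem : ∀ (i : ZMod 2), ∀ a ∈ d.part i, d.sder a ∈ d.part (i + 1)
  sder_mul : ∀ (i : ZMod 2), ∀ a ∈ d.part i, ∀ b : P,
    d.sder (a * b) = d.sder a * b + sg1 i • (a * d.sder b)
  sder_sq : ∀ a : P, d.sder (d.sder a) = d.der a
  lb0_mem : ∀ (i j : ZMod 2), ∀ a ∈ d.part i, ∀ b ∈ d.part j, ∀ n,
    d.lb0 a b n ∈ d.part (i + j + 1)
  lb1_mem : ∀ (i j : ZMod 2), ∀ a ∈ d.part i, ∀ b ∈ d.part j, ∀ n,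
    d.lb1 a b n ∈ d.part (i + j)
  lb0_bnd : ∀ a b n, d.bnd a b ≤ n → d.lb0 a b n = 0
  lb1_bnd : ∀ a b n, d.bnd a b ≤ n → d.lb1 a b n = 0
  -- sesquilinearity in the first argument: `{Da_Λ b} = χ{a_Λ b}`
  sesq1₀ : ∀ a b : P, d.lb0 (d.sder a) b 0 = 0
  sesq1 : ∀ (a b : P) (n : ℕ),
    d.lb0 (d.sder a) b (n + 1) = -((n + 1 : ℕ) : ℂ) • d.lb1 a b n
  sesq1' : ∀ (a b : P) (n : ℕ), d.lb1 (d.sder a) b n = d.lb0 a b n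
  -- sesquilinearity in the second argument:
  -- `{a_Λ Db} = (-1)^{p(a)+1}(D+χ){a_Λ b}`
  sesq2₀ : ∀ (i : ZMod 2), ∀ a ∈ d.part i, ∀ b : P,
    d.lb0 a (d.sder b) 0 = sg1 (i + 1) • d.sder (d.lb0 a b 0)
  sesq2 : ∀ (i : ZMod 2), ∀ a ∈ d.part i, ∀ (b : P) (n : ℕ),
    d.lb0 a (d.sder b) (n + 1) = sg1 (i + 1) •
      (d.sder (d.lb0 a b (n + 1)) + ((n + 1 : ℕ) : ℂ) • d.lb1 a b n)
  sesq2' : ∀ (i : ZMod 2), ∀ a ∈ d.part i, ∀ (b : P) (n : ℕ),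
    d.lb1 a (d.sder b) n = sg1 (i + 1) •
      (d.lb0 a b n - d.sder (d.lb1 a b n))
  -- skewsymmetry: `{a_Λ b} = (-1)^{p(a)p(b)} {b_{-Λ-∇} a}`
  skew0 : ∀ (i j : ZMod 2), ∀ a ∈ d.part i, ∀ b ∈ d.part j, ∀ n,
    d.lb0 a b n = sg i j • ∑ k ∈ Finset.range (d.bnd b a + 1),
      (((-1 : ℂ) ^ (n + k)) / (Nat.factorial k : ℂ)) •
        (d.der ^ k) (d.lb0 b a (n + k) - d.sder (d.lb1 b a (n + k)))
  skew1 : ∀ (i j : ZMod 2), ∀ a ∈ d.part i, ∀ b ∈ d.part j, ∀ n,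
    d.lb1 a b n = -sg i j • ∑ k ∈ Finset.range (d.bnd b a + 1),
      (((-1 : ℂ) ^ (n + k)) / (Nat.factorial k : ℂ)) •
        (d.der ^ k) (d.lb1 b a (n + k))
  -- the `N=1` SUSY Jacobi identity
  -- `{a_Λ{b_Γ c}} = (-1)^{p(a)+1}{{a_Λ b}_{Γ+Λ} c}
  --                + (-1)^{(p(a)+1)(p(b)+1)}{b_Γ{a_Λ c}}`,
  -- written out in the components `1, χ, η, χη` of `C[λ,γ,χ,η] ⊗ P`
  jacobi00 : ∀ (i j : ZMod 2), ∀ a ∈ d.part i, ∀ b ∈ d.part j, ∀ (c : P)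
    (m n : ℕ), d.lb0 a (d.lb0 b c n) m = sg1 (i + 1) •
      ((∑ k ∈ Finset.range (m + 1),
        ((Nat.choose m k : ℕ) : ℂ) • d.lb0 (d.lb0 a b k) c (m + n - k)) +
       (∑ k ∈ Finset.range m,
        (((k + 1) * Nat.choose m (k + 1) : ℕ) : ℂ) •
          d.lb1 (d.lb1 a b k) c (m + n - k - 1))) +
      sg (i + 1) (j + 1) • d.lb0 b (d.lb0 a c m) n
  jacobi10 : ∀ (i j : ZMod 2), ∀ a ∈ d.part i, ∀ b ∈ d.part j, ∀ (c : P)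
    (m n : ℕ), d.lb1 a (d.lb0 b c n) m = sg1 (i + 1) •
      (∑ k ∈ Finset.range (m + 1), ((Nat.choose m k : ℕ) : ℂ) •
        (d.lb1 (d.lb0 a b k) c (m + n - k) - d.lb0 (d.lb1 a b k) c (m + n - k))) +
      (sg (i + 1) (j + 1) * sg1 (j + 1)) • d.lb0 b (d.lb1 a c m) n
  jacobi01 : ∀ (i j : ZMod 2), ∀ a ∈ d.part i, ∀ b ∈ d.part j, ∀ (c : P)
    (m n : ℕ), sg1 (i + 1) • d.lb0 a (d.lb1 b c n) m = sg1 (i + 1) •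
      (∑ k ∈ Finset.range (m + 1),
        ((Nat.choose m k : ℕ) : ℂ) • d.lb1 (d.lb0 a b k) c (m + n - k)) +
      sg (i + 1) (j + 1) • d.lb1 b (d.lb0 a c m) n
  jacobi11 : ∀ (i j : ZMod 2), ∀ a ∈ d.part i, ∀ b ∈ d.part j, ∀ (c : P)
    (m n : ℕ), sg1 i • d.lb1 a (d.lb1 b c n) m = sg1 i •
      (∑ k ∈ Finset.range (m + 1),
        ((Nat.choose m k : ℕ) : ℂ) • d.lb1 (d.lb1 a b k) c (m + n - k)) +
      (sg (i + 1) (j + 1) * sg1 (j + 1)) • d.lb1 b (d.lb1 a c m) n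
  -- the Leibniz rule `{a_Λ bc} = {a_Λ b}c + (-1)^{(p(a)+1)p(b)} b{a_Λ c}`
  leibniz0 : ∀ (i j : ZMod 2), ∀ a ∈ d.part i, ∀ b ∈ d.part j, ∀ (c : P) (n : ℕ),
    d.lb0 a (b * c) n = d.lb0 a b n * c + sg (i + 1) j • (b * d.lb0 a c n)
  leibniz1 : ∀ (i j : ZMod 2), ∀ a ∈ d.part i, ∀ b ∈ d.part j, ∀ (c : P) (n : ℕ),
    d.lb1 a (b * c) n = d.lb1 a b n * c + sg i j • (b * d.lb1 a c n)

/-- The conformal weight space of quasi-primary vectors for a candidate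
`N=1` superconformal vector `G`: elements `a` with
`{G_Λ a} = (2∂ + 2Δλ + χD)a + O(Λ²)`. -/
def sconfWtSet (G : P) (Δ : ℝ) : Set P :=
  {a | d.lb0 G a 0 = (2 : ℂ) • d.der a ∧
       d.lb0 G a 1 = ((2 * Δ : ℝ) : ℂ) • a ∧
       d.lb1 G a 0 = d.sder a}

/-- `G` is an `N=1` superconformal vector of central charge `c`:
`G` is odd, `{G_Λ G} = (2∂ + 3λ + χD)G + (λ²χ/3)c`, and `P` is the
(bounded-below) sum of the conformal weight spaces of `G`. -/
def IsSuperconformal (G : P) (c : ℂ) : Prop :=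
  G ∈ d.part 1 ∧
  d.lb0 G G 0 = (2 : ℂ) • d.der G ∧
  d.lb0 G G 1 = (3 : ℂ) • G ∧
  (∀ n, 2 ≤ n → d.lb0 G G n = 0) ∧
  d.lb1 G G 0 = d.sder G ∧
  d.lb1 G G 1 = 0 ∧
  d.lb1 G G 2 = (2 * c / 3) • (1 : P) ∧
  (∀ n, 3 ≤ n → d.lb1 G G n = 0) ∧
  ∃ M : ℝ, (∀ Δ : ℝ, Δ < M → d.sconfWtSet G Δ ⊆ {0}) ∧
    Submodule.span ℂ (⋃ Δ : ℝ, d.sconfWtSet G Δ) = ⊤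

/-- `a` is primary of conformal weight `Δ` with respect to the `N=1`
superconformal vector `G`: `{G_Λ a} = (2∂ + 2Δλ + χD)a` exactly. -/
def IsPrimary (G a : P) (Δ : ℝ) : Prop :=
  d.lb0 G a 0 = (2 : ℂ) • d.der a ∧
  d.lb0 G a 1 = ((2 * Δ : ℝ) : ℂ) • a ∧
  (∀ n, 2 ≤ n → d.lb0 G a n = 0) ∧
  d.lb1 G a 0 = d.sder a ∧
  (∀ n, 1 ≤ n → d.lb1 G a n = 0)

end SPVAData
/-- The data of an `N=2` SUSY Poisson vertex algebra structure: a
`ℤ/2`-grading, the even derivation `∂ = der`, two odd derivations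
`D = sder1`, `D̃ = sder2`, and the `Λ`-bracket
`{a_Λ b} = ∑_n (λⁿ/n!)(a_{(n|00)}b - χ a_{(n|10)}b + χ̃ a_{(n|01)}b
- χχ̃ a_{(n|11)}b)`, with components `lb00, lb10, lb01, lb11`. -/
structure S2PVAData (P : Type) [Ring P] [Algebra ℂ P] where
  part : ZMod 2 → Submodule ℂ P
  der : P →ₗ[ℂ] P
  sder1 : P →ₗ[ℂ] P
  sder2 : P →ₗ[ℂ] P
  lb00 : P →ₗ[ℂ] P →ₗ[ℂ] (ℕ → P)
  lb10 : P →ₗ[ℂ] P →ₗ[ℂ] (ℕ → P)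
  lb01 : P →ₗ[ℂ] P →ₗ[ℂ] (ℕ → P)
  lb11 : P →ₗ[ℂ] P →ₗ[ℂ] (ℕ → P)
  bnd : P → P → ℕ

namespace S2PVAData

variable {P : Type} [Ring P] [Algebra ℂ P] (d : S2PVAData P)

/-- The underlying `N=0` Poisson vertex algebra data, with `λ`-bracket the
`(n|11)`-component of the `Λ`-bracket. -/
def toPVAData : PVAData P :=
  { part := d.part, der := d.der, lb := d.lb11, bnd := d.bnd }

/-- The axioms of an `N=2` SUSY Poisson vertex algebra.  By the sesquilinearity
of the `Λ`-bracket, an `N=2` SUSY PVA structure is equivalent to the data of a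
Poisson vertex algebra structure for the `λ`-bracket
`{a_λ b} = ∑ (λⁿ/n!) a_{(n|11)} b` together with two supercommuting odd
derivations `D, D̃` with `D² = D̃² = ∂`, both compatible with the `λ`-bracket,
the remaining components being recovered by
`{a_Λ b} = {D̃Da_λ b} - χ{D̃a_λ b} + χ̃{Da_λ b} - χχ̃{a_λ b}`;
this is the form in which we state the axioms. -/
structure IsS2PVA : Prop where
  pva : d.toPVAData.IsPVA
  sder1_mem : ∀ (i : ZMod 2), ∀ a ∈ d.part i, d.sder1 a ∈ d.part (i + 1)
  sder2_mem : ∀ (i : ZMod 2), ∀ a ∈ d.part i, d.sder2 a ∈ d.part (i + 1)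
  sder1_mul : ∀ (i : ZMod 2), ∀ a ∈ d.part i, ∀ b : P,
    d.sder1 (a * b) = d.sder1 a * b + sg1 i • (a * d.sder1 b)
  sder2_mul : ∀ (i : ZMod 2), ∀ a ∈ d.part i, ∀ b : P,
    d.sder2 (a * b) = d.sder2 a * b + sg1 i • (a * d.sder2 b)
  sder1_sq : ∀ a : P, d.sder1 (d.sder1 a) = d.der a
  sder2_sq : ∀ a : P, d.sder2 (d.sder2 a) = d.der a
  anticomm : ∀ a : P, d.sder1 (d.sder2 a) + d.sder2 (d.sder1 a) = 0
  sder1_lb : ∀ (i : ZMod 2), ∀ a ∈ d.part i, ∀ (b : P) (n : ℕ),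
    d.sder1 (d.lb11 a b n) = d.lb11 (d.sder1 a) b n + sg1 i • d.lb11 a (d.sder1 b) n
  sder2_lb : ∀ (i : ZMod 2), ∀ a ∈ d.part i, ∀ (b : P) (n : ℕ),
    d.sder2 (d.lb11 a b n) = d.lb11 (d.sder2 a) b n + sg1 i • d.lb11 a (d.sder2 b) n
  comp01 : ∀ (a b : P) (n : ℕ), d.lb01 a b n = d.lb11 (d.sder1 a) b n
  comp10 : ∀ (a b : P) (n : ℕ), d.lb10 a b n = d.lb11 (d.sder2 a) b n
  comp00 : ∀ (a b : P) (n : ℕ), d.lb00 a b n = d.lb11 (d.sder2 (d.sder1 a)) b n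

/-- The conformal weight space of quasi-primary vectors for a candidate
`N=2` superconformal vector `J`: elements `a` with
`{J_Λ a} = (2∂ + 2Δλ + χD + χ̃D̃)a + O(Λ²)`. -/
def s2confWtSet (J : P) (Δ : ℝ) : Set P :=
  {a | d.lb00 J a 0 = (2 : ℂ) • d.der a ∧
       d.lb00 J a 1 = ((2 * Δ : ℝ) : ℂ) • a ∧
       d.lb10 J a 0 = -d.sder1 a ∧
       d.lb01 J a 0 = d.sder2 a}

/-- The `N=2` superconformal self-bracket relation
`{J_Λ J} = (2∂ + 2λ + χD + χ̃D̃)J + (λχχ̃/3)c` of Definition 3.4 (i),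
in components. -/
def SelfBracketRel (J : P) (c : ℂ) : Prop :=
  d.lb00 J J 0 = (2 : ℂ) • d.der J ∧
  d.lb00 J J 1 = (2 : ℂ) • J ∧
  (∀ n, 2 ≤ n → d.lb00 J J n = 0) ∧
  d.lb10 J J 0 = -d.sder1 J ∧
  (∀ n, 1 ≤ n → d.lb10 J J n = 0) ∧
  d.lb01 J J 0 = d.sder2 J ∧
  (∀ n, 1 ≤ n → d.lb01 J J n = 0) ∧
  d.lb11 J J 0 = 0 ∧
  d.lb11 J J 1 = (-(c / 3)) • (1 : P) ∧
  (∀ n, 2 ≤ n → d.lb11 J J n = 0)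

/-- `J` is an `N=2` superconformal vector of central charge `c`. -/
def IsSuperconformal (J : P) (c : ℂ) : Prop :=
  J ∈ d.part 0 ∧ d.SelfBracketRel J c ∧
  ∃ M : ℝ, (∀ Δ : ℝ, Δ < M → d.s2confWtSet J Δ ⊆ {0}) ∧
    Submodule.span ℂ (⋃ Δ : ℝ, d.s2confWtSet J Δ) = ⊤

/-- `a` is primary of conformal weight `Δ` with respect to the `N=2`
superconformal vector `J`: `{J_Λ a} = (2∂ + 2Δλ + χD + χ̃D̃)a` exactly. -/
def IsPrimary (J a : P) (Δ : ℝ) : Prop :=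
  d.lb00 J a 0 = (2 : ℂ) • d.der a ∧
  d.lb00 J a 1 = ((2 * Δ : ℝ) : ℂ) • a ∧
  (∀ n, 2 ≤ n → d.lb00 J a n = 0) ∧
  d.lb10 J a 0 = -d.sder1 a ∧
  (∀ n, 1 ≤ n → d.lb10 J a n = 0) ∧
  d.lb01 J a 0 = d.sder2 a ∧
  (∀ n, 1 ≤ n → d.lb01 J a n = 0) ∧
  (∀ n, d.lb11 J a n = 0)

end S2PVAData
/-- The `N=0` Poisson vertex algebra data induced from an `N=1` SUSY PVA
structure: the `λ`-bracket is `{a_λ b} = ∑ (λⁿ/n!) a_{(n|1)} b`. -/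
def SPVAData.toPVAData {P : Type} [Ring P] [Algebra ℂ P] (d : SPVAData P) :
    PVAData P :=
  { part := d.part, der := d.der, lb := d.lb1, bnd := d.bnd }

/-- The first `N=1` SUSY PVA data induced from an `N=2` SUSY PVA structure:
`{a_Λ b} = ∑ (λⁿ/n!)(a_{(n|01)}b + χ a_{(n|11)}b)`, with odd derivation `D`. -/
def S2PVAData.toSPVAData₁ {P : Type} [Ring P] [Algebra ℂ P] (d : S2PVAData P) :
    SPVAData P :=
  { part := d.part, der := d.der, sder := d.sder1,
    lb0 := d.lb01, lb1 := d.lb11, bnd := d.bnd }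

/-- The second `N=1` SUSY PVA data induced from an `N=2` SUSY PVA structure:
`{a_Λ̃ b} = ∑ (λⁿ/n!)(a_{(n|10)}b + χ̃ a_{(n|11)}b)`, with odd derivation `D̃`. -/
def S2PVAData.toSPVAData₂ {P : Type} [Ring P] [Algebra ℂ P] (d : S2PVAData P) :
    SPVAData P :=
  { part := d.part, der := d.der, sder := d.sder2,
    lb0 := d.lb10, lb1 := d.lb11, bnd := d.bnd }

/-- The `N=1` SUSY bracket data induced from a `λ`-bracket and an odd
endomorphism `D`: `{a_Λ b}⁻ = {Da_λ b} + χ{a_λ b}`. -/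
def PVAData.inducedSPVA {P : Type} [Ring P] [Algebra ℂ P] (d : PVAData P)
    (D : P →ₗ[ℂ] P) : SPVAData P :=
  { part := d.part, der := d.der, sder := D,
    lb0 := d.lb.comp D, lb1 := d.lb,
    bnd := fun a b => max (d.bnd (D a) b) (d.bnd a b) }

/-- The `N=2` SUSY bracket data induced from a `λ`-bracket and two odd
endomorphisms `D, D̃`:
`{a_Λ b}⁻ = {D̃Da_λ b} - χ{D̃a_λ b} + χ̃{Da_λ b} - χχ̃{a_λ b}`. -/
def PVAData.inducedS2PVA {P : Type} [Ring P] [Algebra ℂ P] (d : PVAData P)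
    (D Dt : P →ₗ[ℂ] P) : S2PVAData P :=
  { part := d.part, der := d.der, sder1 := D, sder2 := Dt,
    lb00 := d.lb.comp (Dt ∘ₗ D), lb10 := d.lb.comp Dt,
    lb01 := d.lb.comp D, lb11 := d.lb,
    bnd := fun a b =>
      max (max (d.bnd (Dt (D a)) b) (d.bnd (Dt a) b))
        (max (d.bnd (D a) b) (d.bnd a b)) }

lemma zmod_two_eq_zero_or_one (i : ZMod 2) : i = 0 ∨ i = 1 := by
  revert i
  decide

lemma sg1_add_one (i : ZMod 2) : sg1 (i + 1) = -sg1 i := by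
  rcases zmod_two_eq_zero_or_one i with rfl | rfl <;>
    simp [sg1, ZMod.val_one, CharTwo.add_self_eq_zero]

lemma sg1_mul_self (i : ZMod 2) : sg1 i * sg1 i = 1 := by
  rw [sg1, ← mul_pow]
  simp

lemma sg_comm (i j : ZMod 2) : sg i j = sg j i := by
  rw [sg, sg, mul_comm]

lemma sg_add_one_left (i j : ZMod 2) : sg (i + 1) j = sg i j * sg1 j := by
  rcases zmod_two_eq_zero_or_one i with rfl | rfl <;>
    rcases zmod_two_eq_zero_or_one j with rfl | rfl <;>
    simp [sg, sg1, ZMod.val_one, CharTwo.add_self_eq_zero]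

lemma sg_add_one_right (i j : ZMod 2) : sg i (j + 1) = sg i j * sg1 i := by
  rw [sg_comm, sg_add_one_left, sg_comm]

/-- Sums of a sequence over two initial ranges agree when both contain its support. -/
lemma sum_range_succ_eq_of_support {M : Type*} [AddCommMonoid M] (f : ℕ → M) {m n : ℕ}
    (hm : ∀ k, m ≤ k → f k = 0) (hn : ∀ k, n ≤ k → f k = 0) :
    ∑ k ∈ Finset.range (m + 1), f k = ∑ k ∈ Finset.range (n + 1), f k := by
  rw [Finset.eventually_constant_sum hm m.le_succ, Finset.eventually_constant_sum hn n.le_succ]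
  rcases le_total m n with hmn | hmn
  · exact (Finset.eventually_constant_sum hm hmn).symm
  · exact Finset.eventually_constant_sum hn hmn

namespace PVAData

variable {P : Type} [Ring P] [Algebra ℂ P] {d : PVAData P} {D : P →ₗ[ℂ] P}

/-- `{a_λ Db} = (-1)^{p(a)} (D{a_λ b} - {Da_λ b})`. -/
lemma lb_apply_right_of_compat
    (hlb : ∀ (i : ZMod 2), ∀ a ∈ d.part i, ∀ (b : P) (n : ℕ),
      D (d.lb a b n) = d.lb (D a) b n + sg1 i • d.lb a (D b) n)
    {i : ZMod 2} {a : P} (ha : a ∈ d.part i) (b : P) (n : ℕ) :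
    d.lb a (D b) n = sg1 i • (D (d.lb a b n) - d.lb (D a) b n) := by
  rw [hlb i a ha, add_sub_cancel_left, smul_smul, sg1_mul_self, one_smul]

/-- Substituting `∂a` in the left slot of an iterated bracket, as in the Jacobi identity. -/
lemma IsPVA.sum_choose_lb_lb_der (h : d.IsPVA) (a b c : P) (m n : ℕ) :
    ∑ k ∈ Finset.range (m + 1),
      ((Nat.choose m k : ℕ) : ℂ) • d.lb (d.lb (d.der a) b k) c (m + n - k) =
    -∑ k ∈ Finset.range m, (((k + 1) * Nat.choose m (k + 1) : ℕ) : ℂ) •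
      d.lb (d.lb a b k) c (m + n - k - 1) := by
  rw [Finset.sum_range_succ', h.sesq1₀, ← Finset.sum_neg_distrib]
  simp only [map_zero, LinearMap.zero_apply, Pi.zero_apply, smul_zero, add_zero]
  refine Finset.sum_congr rfl fun k _ => ?_
  rw [h.sesq1, map_smul, LinearMap.smul_apply, Pi.smul_apply, smul_smul, ← neg_smul,
    Nat.sub_sub (m + n)]
  congr 1
  push_cast
  ring

/-- An odd derivation `D` with `D² = ∂` which is a derivation of the `λ`-bracket induces an
`N=1` SUSY Poisson vertex algebra. -/
theorem IsPVA.inducedSPVA_isSPVA (h : d.IsPVA)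
    (hD : ∀ (i : ZMod 2), ∀ a ∈ d.part i, D a ∈ d.part (i + 1))
    (hmul : ∀ (i : ZMod 2), ∀ a ∈ d.part i, ∀ b : P,
      D (a * b) = D a * b + sg1 i • (a * D b))
    (hsq : ∀ a : P, D (D a) = d.der a)
    (hlb : ∀ (i : ZMod 2), ∀ a ∈ d.part i, ∀ (b : P) (n : ℕ),
      D (d.lb a b n) = d.lb (D a) b n + sg1 i • d.lb a (D b) n) :
    (d.inducedSPVA D).IsSPVA where
  compl := h.compl
  one_mem := h.one_mem
  mul_mem := h.mul_mem
  scomm := h.scomm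
  der_mem := h.der_mem
  der_mul := h.der_mul
  sder_mem := hD
  sder_mul := hmul
  sder_sq := hsq
  lb0_mem i j a ha b hb n := by
    rw [show i + j + 1 = i + 1 + j by ring]
    exact h.lb_mem _ _ _ (hD i a ha) b hb n
  lb1_mem := h.lb_mem
  lb0_bnd a b n hn := h.lb_bnd _ _ _ ((le_max_left _ _).trans hn)
  lb1_bnd a b n hn := h.lb_bnd _ _ _ ((le_max_right _ _).trans hn)
  sesq1₀ a b := by
    simp only [inducedSPVA, LinearMap.comp_apply, hsq]
    exact h.sesq1₀ a b
  sesq1 a b n := by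
    simp only [inducedSPVA, LinearMap.comp_apply, hsq]
    exact h.sesq1 a b n
  sesq1' _ _ _ := rfl
  sesq2₀ i a ha b := by
    simp only [inducedSPVA, LinearMap.comp_apply]
    rw [lb_apply_right_of_compat hlb (hD i a ha), hsq, h.sesq1₀, sub_zero]
  sesq2 i a ha b n := by
    simp only [inducedSPVA, LinearMap.comp_apply]
    rw [lb_apply_right_of_compat hlb (hD i a ha), hsq, h.sesq1, neg_smul, sub_neg_eq_add]
  sesq2' i a ha b n := by
    simp only [inducedSPVA, LinearMap.comp_apply]
    rw [lb_apply_right_of_compat hlb ha, sg1_add_one]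
    module
  skew0 i j a ha b hb n := by
    simp only [inducedSPVA, LinearMap.comp_apply]
    have key : ∀ k, d.lb (D b) a k - D (d.lb b a k) = -sg1 j • d.lb b (D a) k := fun k => by
      rw [hlb j b hb]
      module
    simp only [key, map_smul, smul_comm _ (-sg1 j), ← Finset.smul_sum]
    rw [h.skew _ _ _ (hD i a ha) b hb n, sg_add_one_left, smul_smul, neg_mul_eq_mul_neg,
      mul_comm (sg i j)]
    congr 1
    refine sum_range_succ_eq_of_support _ (fun k hk => ?_) fun k hk => ?_
    · rw [h.lb_bnd _ _ _ (hk.trans (Nat.le_add_left k n)), map_zero, smul_zero]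
    · have hk' := hk.trans (Nat.le_add_left k n)
      rw [lb_apply_right_of_compat hlb hb, h.lb_bnd b a _ ((le_max_right _ _).trans hk'),
        h.lb_bnd (D b) a _ ((le_max_left _ _).trans hk')]
      simp
  skew1 i j a ha b hb n := by
    simp only [inducedSPVA]
    rw [h.skew i j a ha b hb n]
    congr 1
    refine sum_range_succ_eq_of_support _ (fun k hk => ?_) fun k hk => ?_
    · rw [h.lb_bnd _ _ _ (hk.trans (Nat.le_add_left k n)), map_zero, smul_zero]
    · rw [h.lb_bnd _ _ _ (((le_max_right _ _).trans hk).trans (Nat.le_add_left k n)), map_zero,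
        smul_zero]
  jacobi00 i j a ha b hb c m n := by
    simp only [inducedSPVA, LinearMap.comp_apply]
    rw [h.jacobi _ _ _ (hD i a ha) _ (hD j b hb) c m n]
    congr 1
    simp only [hlb _ _ (hD i a ha), hsq, map_add, map_smul, LinearMap.add_apply,
      LinearMap.smul_apply, Pi.add_apply, Pi.smul_apply, smul_add, Finset.sum_add_distrib,
      h.sum_choose_lb_lb_der, smul_comm (Nat.cast _) (sg1 (i + 1)), ← Finset.smul_sum]
    rw [smul_smul, sg1_mul_self]
    module
  jacobi10 i j a ha b hb c m n := by
    simp only [inducedSPVA, LinearMap.comp_apply]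
    rw [h.jacobi _ _ _ ha _ (hD j b hb) c m n]
    have key : ∀ k l, d.lb (d.lb (D a) b k) c l - d.lb (D (d.lb a b k)) c l =
        sg1 (i + 1) • d.lb (d.lb a (D b) k) c l := fun k l => by
      simp only [hlb _ _ ha, map_add, map_smul, LinearMap.add_apply,
        LinearMap.smul_apply, Pi.add_apply, Pi.smul_apply, sg1_add_one]
      module
    simp only [key, smul_comm (Nat.cast _) (sg1 (i + 1)), ← Finset.smul_sum]
    rw [smul_smul, sg1_mul_self, one_smul, sg_add_one_left, mul_assoc, sg1_mul_self, mul_one]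
  jacobi01 i j a ha b hb c m n := by
    simp only [inducedSPVA, LinearMap.comp_apply]
    rw [h.jacobi _ _ _ (hD i a ha) _ hb c m n, smul_add, smul_smul, sg_add_one_right,
      mul_comm (sg1 (i + 1))]
  jacobi11 i j a ha b hb c m n := by
    simp only [inducedSPVA]
    rw [h.jacobi _ _ _ ha _ hb c m n, smul_add, smul_smul, sg_add_one_left, mul_assoc,
      sg1_mul_self, mul_one, sg_add_one_right, mul_comm (sg1 i)]
  leibniz0 i j a ha b hb c n := h.leibniz _ _ _ (hD i a ha) b hb c n
  leibniz1 := h.leibniz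

end PVAData

/-- Let `P` be a Poisson vertex algebra with `λ`-bracket
`{·_λ·}`, and for an odd endomorphism `D` of `P` define the induced
`Λ`-bracket `{a_Λ b}⁻ := {Da_λ b} + χ{a_λ b}`.  The following are equivalent:
(1) `(P, 1, ∇ = (∂,D), {·_Λ·}⁻, ·)` is an `N=1` SUSY Poisson vertex algebra;
(2) `D` is an odd derivation of `P` with `D² = ∂` and
    `D{a_λ b} = {Da_λ b} + (-1)^{p(a)}{a_λ Db}` for all `a, b ∈ P`. -/
theorem stmt_5 {P : Type} [Ring P] [Algebra ℂ P]
    (d : PVAData P) (h : d.IsPVA) (D : P →ₗ[ℂ] P) :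
    (d.inducedSPVA D).IsSPVA ↔
      ((∀ (i : ZMod 2), ∀ a ∈ d.part i, D a ∈ d.part (i + 1)) ∧
       (∀ (i : ZMod 2), ∀ a ∈ d.part i, ∀ b : P,
         D (a * b) = D a * b + sg1 i • (a * D b)) ∧
       (∀ a : P, D (D a) = d.der a) ∧
       (∀ (i : ZMod 2), ∀ a ∈ d.part i, ∀ (b : P) (n : ℕ),
         D (d.lb a b n) = d.lb (D a) b n + sg1 i • d.lb a (D b) n)) := by
  refine ⟨fun hS => ⟨hS.sder_mem, hS.sder_mul, hS.sder_sq, fun i a ha b n => ?_⟩,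
    fun ⟨hD, hmul, hsq, hlb⟩ => h.inducedSPVA_isSPVA hD hmul hsq hlb⟩
  have hs : d.lb a (D b) n = sg1 (i + 1) • (d.lb (D a) b n - D (d.lb a b n)) :=
    hS.sesq2' i a ha b n
  rw [hs, sg1_add_one, smul_smul, mul_neg, sg1_mul_self]
  module
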